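/- arXiv:2405.13398 — 5 statements merged into one kernel-verified Lean document; each statement's English description precedes it below -/
import Mathlib

section
/- For every formula φ of epistemic logic, φ is EL-valid if and only if its translation T(φ) is AK-valid. -/
/- Agent-knowledge (AK) logic: language -/
inductive AKForm (PA PK NA NK : Type) : Type
  | propA : PA → AKForm PA PK NA NK
  | propK : PK → AKForm PA PK NA NK
  | nomA  : NA → AKForm PA PK NA NK
  | nomK  : NK → AKForm PA PK NA NK
  | neg   : AKForm PA PK NA NK → AKForm PA PK NA NK
  | and   : AKForm PA PK NA NK → AKForm PA PK NA NK → AKForm PA PK NA NK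
  | boxA  : AKForm PA PK NA NK → AKForm PA PK NA NK
  | boxK  : AKForm PA PK NA NK → AKForm PA PK NA NK
  | atA   : NA → AKForm PA PK NA NK → AKForm PA PK NA NK
  | atK   : NK → AKForm PA PK NA NK → AKForm PA PK NA NK

/- AK models: nominals denote single points (singleton valuations) -/
structure AKModel (PA PK NA NK : Type) where
  WA : Type
  WK : Type
  neWA : Nonempty WA
  neWK : Nonempty WK
  R : WK → WA → WA → Prop
  S : WA → WK → WK → Prop
  VA : PA → Set WA
  VK : PK → Set WK
  nA : NA → WA
  nK : NK → WK

def AKSat {PA PK NA NK : Type} (M : AKModel PA PK NA NK) :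
    M.WA → M.WK → AKForm PA PK NA NK → Prop
  | x, _, .propA p => x ∈ M.VA p
  | _, y, .propK p => y ∈ M.VK p
  | x, _, .nomA a => x = M.nA a
  | _, y, .nomK k => y = M.nK k
  | x, y, .neg φ => ¬ AKSat M x y φ
  | x, y, .and φ ψ => AKSat M x y φ ∧ AKSat M x y ψ
  | x, y, .boxA φ => ∀ x', M.R y x x' → AKSat M x' y φ
  | x, y, .boxK φ => ∀ y', M.S x y y' → AKSat M x y' φ
  | x, y, .atA a φ => AKSat M (M.nA a) y φ
  | x, y, .atK k φ => AKSat M x (M.nK k) φ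

def AKValid {PA PK NA NK : Type} (φ : AKForm PA PK NA NK) : Prop :=
  ∀ (M : AKModel PA PK NA NK) (x : M.WA) (y : M.WK), AKSat M x y φ

/- Epistemic logic (EL): language -/
inductive ELForm (P A : Type) : Type
  | atom : P → ELForm P A
  | neg  : ELForm P A → ELForm P A
  | and  : ELForm P A → ELForm P A → ELForm P A
  | know : A → ELForm P A → ELForm P A

structure ELModel (P A : Type) where
  W : Type
  neW : Nonempty W
  R : A → W → W → Prop
  V : P → Set W

def ELSat {P A : Type} (M : ELModel P A) : M.W → ELForm P A → Prop
  | w, .atom p => w ∈ M.V p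
  | w, .neg φ => ¬ ELSat M w φ
  | w, .and φ ψ => ELSat M w φ ∧ ELSat M w ψ
  | w, .know i φ => ∀ v, M.R i w v → ELSat M v φ

def ELValid {P A : Type} (φ : ELForm P A) : Prop :=
  ∀ (M : ELModel P A) (w : M.W), ELSat M w φ

/- The translation T, determined by bijections Prop ≃ Prop_K and A ≃ Nom_A -/
def Tr {P A PA PK NA NK : Type} (tP : P ≃ PK) (tA : A ≃ NA) :
    ELForm P A → AKForm PA PK NA NK
  | .atom p => .propK (tP p)
  | .neg φ => .neg (Tr tP tA φ)
  | .and φ ψ => .and (Tr tP tA φ) (Tr tP tA ψ)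
  | .know i φ => .atA (tA i) (.boxK (Tr tP tA φ))

/-- The epistemic model on the knowledge points of an AK model, where agent `i` uses the relation
attached to the agent named by `tA i`. -/
def AKModel.toELModel {P A PA PK NA NK : Type} (tP : P ≃ PK) (tA : A ≃ NA)
    (M : AKModel PA PK NA NK) : ELModel P A where
  W := M.WK
  neW := M.neWK
  R i := M.S (M.nA (tA i))
  V p := M.VK (tP p)

theorem AKModel.elSat_toELModel_iff {P A PA PK NA NK : Type} (tP : P ≃ PK) (tA : A ≃ NA)
    (M : AKModel PA PK NA NK) (φ : ELForm P A) (x : M.WA) (y : M.WK) :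
    ELSat (M.toELModel tP tA) y φ ↔ AKSat M x y (Tr tP tA φ) := by
  induction φ generalizing x y with
  | atom p => exact Iff.rfl
  | neg φ ih => exact not_congr (ih x y)
  | and φ ψ ihφ ihψ => exact and_congr (ihφ x y) (ihψ x y)
  | know i φ ih =>
    exact forall_congr' fun v => imp_congr Iff.rfl (ih (M.nA (tA i)) v)

/-- The AK model whose agent points are the agents of an epistemic model and whose knowledge
points are its worlds. -/
noncomputable def ELModel.toAKModel {P A : Type} [Nonempty A] (PA : Type) {PK NA : Type}
    (NK : Type) (tP : P ≃ PK) (tA : A ≃ NA) (M : ELModel P A) : AKModel PA PK NA NK where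
  WA := A
  WK := M.W
  neWA := inferInstance
  neWK := M.neW
  R _ _ _ := False
  S := M.R
  VA _ := ∅
  VK q := M.V (tP.symm q)
  nA := tA.symm
  nK _ := M.neW.some

theorem ELModel.toELModel_toAKModel {P A PA PK NA NK : Type} [Nonempty A]
    (tP : P ≃ PK) (tA : A ≃ NA) (M : ELModel P A) :
    (M.toAKModel PA NK tP tA).toELModel tP tA = M := by
  simp [AKModel.toELModel, ELModel.toAKModel]

/-- φ is EL-valid iff its translation T(φ) is AK-valid. -/
theorem el_valid_iff_ak_valid_translation
    {P A PA PK NA NK : Type} [Countable P] [Countable A]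
    [Countable PA] [Countable PK] [Countable NA] [Countable NK] [Nonempty A]
    (tP : P ≃ PK) (tA : A ≃ NA) (φ : ELForm P A) :
    ELValid φ ↔ AKValid (Tr tP tA φ (PA := PA) (NK := NK)) := by
  constructor
  · intro h M x y
    exact (M.elSat_toELModel_iff tP tA φ x y).1 (h (M.toELModel tP tA) y)
  · intro h M
    rw [← M.toELModel_toAKModel (PA := PA) (NK := NK) tP tA]
    intro w
    let x : (M.toAKModel PA NK tP tA).WA := Classical.arbitrary A
    exact ((M.toAKModel PA NK tP tA).elSat_toELModel_iff tP tA φ x w).2 (h _ x w)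
end

section
/- Let M_AK be an AK model and M_EL^β its induced EL model. Then for every EL formula φ, every x∈W_A, and every y∈W_K, M_AK, (x, y) ⊨ T(φ) if and only if M_EL^β, y ⊨ φ. -/
/- The induced EL model M_EL^β of an AK model:
   worlds W_K, y S_i^β z iff y S_{T(i)^V} z, V^β(p) = V(T(p)). -/
def betaModel {P A PA PK NA NK : Type} (tP : P ≃ PK) (tA : A ≃ NA)
    (M : AKModel PA PK NA NK) : ELModel P A where
  W := M.WK
  neW := M.neWK
  R := fun i => M.S (M.nA (tA i))
  V := fun p => M.VK (tP p)

/-- For every EL formula φ, every x ∈ W_A and y ∈ W_K,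
    M_AK, (x, y) ⊨ T(φ) iff M_EL^β, y ⊨ φ. -/
theorem ak_sat_trans_iff_beta_sat
    {P A PA PK NA NK : Type}
    (tP : P ≃ PK) (tA : A ≃ NA) (M : AKModel PA PK NA NK)
    (φ : ELForm P A) (x : M.WA) (y : M.WK) :
    AKSat M x y (Tr tP tA φ) ↔ ELSat (betaModel tP tA M) y φ := by
  induction φ generalizing x y with
  | atom p => exact Iff.rfl
  | neg φ ih => exact not_congr (ih x y)
  | and φ ψ ihφ ihψ => exact and_congr (ihφ x y) (ihψ x y)
  | know i φ ih => exact forall₂_congr fun z _ => ih (M.nA (tA i)) z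
end

section
/- There exist an epistemic social network model M in which every knowledge relation ∼_a is an equivalence relation, a world w, an agent a, a nominal n, and a propositional variable p such that M, (w, a) ⊨ @_n K p but M, (w, a) ⊭ p. Hence the Facebook-logic formula @_n K p → p is not valid on the class of epistemic social network models with equivalence knowledge relations. -/
/- Facebook logic: language -/
inductive FBForm (P N : Type) : Type
  | atom   : P → FBForm P N
  | nom    : N → FBForm P N
  | neg    : FBForm P N → FBForm P N
  | and    : FBForm P N → FBForm P N → FBForm P N
  | know   : FBForm P N → FBForm P N
  | friend : FBForm P N → FBForm P N
  | at_    : N → FBForm P N → FBForm P N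

/- Epistemic social network models (with equivalence knowledge relations,
   irreflexive symmetric friendship relations, and nominals denoting agents). -/
structure SNModel (P N : Type) where
  W : Type
  A : Type
  sim : A → W → W → Prop
  simEquiv : ∀ a, Equivalence (sim a)
  fr : W → A → A → Prop
  frIrrefl : ∀ w a, ¬ fr w a a
  frSymm : ∀ w a b, fr w a b → fr w b a
  V : P → Set (W × A)
  nV : N → A

def FBSat {P N : Type} (M : SNModel P N) : M.W → M.A → FBForm P N → Prop
  | w, a, .atom p => (w, a) ∈ M.V p
  | _, a, .nom n => a = M.nV n
  | w, a, .neg φ => ¬ FBSat M w a φ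
  | w, a, .and φ ψ => FBSat M w a φ ∧ FBSat M w a ψ
  | w, a, .know φ => ∀ v, M.sim a v w → FBSat M v a φ
  | w, a, .friend φ => ∀ b, M.fr w b a → FBSat M w b φ
  | w, _, .at_ n φ => FBSat M w (M.nV n) φ

/-- Implication defined classically: φ → ψ := ¬(φ ∧ ¬ψ). -/
def FBForm.imp {P N : Type} (φ ψ : FBForm P N) : FBForm P N := .neg (.and φ (.neg ψ))

/-- A single world with two strangers, in which every nominal names `true` and every
propositional variable holds exactly of `true`. -/
def twoAgentModel (P N : Type) : SNModel P N where
  W := Unit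
  A := Bool
  sim _ _ _ := True
  simEquiv _ := ⟨fun _ => trivial, fun _ => trivial, fun _ _ => trivial⟩
  fr _ _ _ := False
  frIrrefl _ _ := id
  frSymm _ _ _ := id
  V _ := {x | x.2 = true}
  nV _ := true

theorem twoAgentModel_sat_at_know {P N : Type} (p : P) (n : N) (a : Bool) :
    FBSat (twoAgentModel P N) () a (.at_ n (.know (.atom p))) :=
  fun _ _ => rfl

theorem twoAgentModel_not_sat_atom {P N : Type} (p : P) :
    ¬ FBSat (twoAgentModel P N) () false (.atom p) :=
  Bool.false_ne_true

/-- there is an epistemic social network model (with equivalence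
    knowledge relations), a world w, an agent a with M,(w,a) ⊨ @_n K p and
    M,(w,a) ⊭ p; hence @_n K p → p is not valid on this class of models. -/
theorem facebook_at_know_not_factive (P N : Type) (p : P) (n : N) :
    (∃ (M : SNModel P N) (w : M.W) (a : M.A),
        FBSat M w a (.at_ n (.know (.atom p))) ∧ ¬ FBSat M w a (.atom p)) ∧
    ¬ (∀ (M : SNModel P N) (w : M.W) (a : M.A),
        FBSat M w a (FBForm.imp (.at_ n (.know (.atom p))) (.atom p))) := by
  exact ⟨⟨twoAgentModel P N, (), false, twoAgentModel_sat_at_know p n false,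
      twoAgentModel_not_sat_atom p⟩,
    fun h => h (twoAgentModel P N) () false
      ⟨twoAgentModel_sat_at_know p n false, twoAgentModel_not_sat_atom p⟩⟩
end

section
/- The AK formula ◇_A a ∧ @_a □_K p_K → ◇_A □_K p_K is AK-valid, where a∈Nom_A and p_K∈Prop_K. -/
/-- Implication defined classically: φ → ψ := ¬(φ ∧ ¬ψ). -/
def AKForm.imp {PA PK NA NK : Type} (φ ψ : AKForm PA PK NA NK) : AKForm PA PK NA NK :=
  .neg (.and φ (.neg ψ))

/-- ◇_A, the dual of □_A. -/
def AKForm.diaA {PA PK NA NK : Type} (φ : AKForm PA PK NA NK) : AKForm PA PK NA NK :=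
  .neg (.boxA (.neg φ))

/-- ◇_A a ∧ @_a □_K p_K → ◇_A □_K p_K is AK-valid. -/
theorem diaA_nom_and_at_boxK_imp_diaA_boxK_valid
    {PA PK NA NK : Type} (a : NA) (pK : PK) :
    AKValid (PA := PA) (NK := NK)
      (AKForm.imp
        (.and (AKForm.diaA (.nomA a)) (.atA a (.boxK (.propK pK))))
        (AKForm.diaA (.boxK (.propK pK)))) := by
  rintro M x y ⟨⟨hdia, hat⟩, hbox⟩
  simp only [AKForm.diaA, AKSat] at hdia hat hbox
  refine hdia fun x' hR hx' => hbox fun h => h x' hR ?_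
  rw [hx']
  exact hat
end

section
/- Finite model property: if an AK formula φ is not AK-valid, then there is an AK model with finite W_A and finite W_K and a pair (x,y) at which φ fails. -/
open scoped symmDiff

namespace AKForm

variable {PA PK NA NK : Type}

/-- The subformulas of a formula, together with the nominals occurring in its `@`-operators. -/
def closure : AKForm PA PK NA NK → Set (AKForm PA PK NA NK)
  | .propA p => {.propA p}
  | .propK p => {.propK p}
  | .nomA a => {.nomA a}
  | .nomK k => {.nomK k}
  | .neg φ => insert (.neg φ) φ.closure
  | .and φ ψ => insert (.and φ ψ) (φ.closure ∪ ψ.closure)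
  | .boxA φ => insert (.boxA φ) φ.closure
  | .boxK φ => insert (.boxK φ) φ.closure
  | .atA a φ => insert (.atA a φ) (insert (.nomA a) φ.closure)
  | .atK k φ => insert (.atK k φ) (insert (.nomK k) φ.closure)

theorem finite_closure (φ : AKForm PA PK NA NK) : φ.closure.Finite := by
  induction φ <;> simp_all [closure]

theorem self_mem_closure (φ : AKForm PA PK NA NK) : φ ∈ φ.closure := by
  cases φ <;> simp [closure]

end AKForm

namespace AKModel

variable {PA PK NA NK : Type} (M : AKModel PA PK NA NK) (Γ : Set (AKForm PA PK NA NK))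
  (x₀ : M.WA) (y₀ : M.WK)

/-- The formulas of `Γ` true at a pair. -/
def typeAt (x : M.WA) (y : M.WK) : Set Γ := {ψ | AKSat M x y ψ.1}

/-- An enumeration of `x₀` and the agents named by a nominal in `Γ`. -/
def probeA : Option Γ → M.WA
  | some ⟨.nomA a, _⟩ => M.nA a
  | _ => x₀

/-- An enumeration of `y₀` and the knowledge points named by a nominal in `Γ`. -/
def probeK : Option Γ → M.WK
  | some ⟨.nomK k, _⟩ => M.nK k
  | _ => y₀

/-- The types an agent realises against `y₀` and all named knowledge points. -/
def profileA (x : M.WA) : Option Γ → Set Γ := fun o => M.typeAt Γ x (M.probeK Γ y₀ o)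

/-- The types a knowledge point realises against `x₀` and all named agents. -/
def profileK (y : M.WK) : Option Γ → Set Γ := fun o => M.typeAt Γ (M.probeA Γ x₀ o) y

/-- Agents of the finite model: a realised profile tagged by a set of formulas, where the profiles
of named agents only carry the empty tag. -/
def PointA : Type :=
  {P : (Option Γ → Set Γ) × Set Γ //
    ∃ x, M.profileA Γ y₀ x = P.1 ∧ ((∃ a, .nomA a ∈ Γ ∧ x = M.nA a) → P.2 = ∅)}

/-- Knowledge points of the finite model: a realised profile tagged by a set of formulas, where the
profiles of named points only carry the empty tag. -/
def PointK : Type :=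
  {P : (Option Γ → Set Γ) × Set Γ //
    ∃ y, M.profileK Γ x₀ y = P.1 ∧ ((∃ k, .nomK k ∈ Γ ∧ y = M.nK k) → P.2 = ∅)}

variable {M Γ x₀ y₀}

theorem sat_congr_of_typeAt_eq {x x' : M.WA} {y y' : M.WK}
    (h : M.typeAt Γ x y = M.typeAt Γ x' y') {ψ : AKForm PA PK NA NK} (hψ : ψ ∈ Γ) :
    AKSat M x y ψ ↔ AKSat M x' y' ψ :=
  Set.ext_iff.1 h ⟨ψ, hψ⟩

theorem typeAt_base_eq_of_profileA_eq {x x' : M.WA}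
    (h : M.profileA Γ y₀ x = M.profileA Γ y₀ x') : M.typeAt Γ x y₀ = M.typeAt Γ x' y₀ :=
  congrFun h none

theorem typeAt_base_eq_of_profileK_eq {y y' : M.WK}
    (h : M.profileK Γ x₀ y = M.profileK Γ x₀ y') : M.typeAt Γ x₀ y = M.typeAt Γ x₀ y' :=
  congrFun h none

theorem typeAt_nK_eq_of_profileA_eq {x x' : M.WA}
    (h : M.profileA Γ y₀ x = M.profileA Γ y₀ x') {k : NK} (hk : .nomK k ∈ Γ) :
    M.typeAt Γ x (M.nK k) = M.typeAt Γ x' (M.nK k) :=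
  congrFun h (some ⟨_, hk⟩)

theorem typeAt_nA_eq_of_profileK_eq {y y' : M.WK}
    (h : M.profileK Γ x₀ y = M.profileK Γ x₀ y') {a : NA} (ha : .nomA a ∈ Γ) :
    M.typeAt Γ (M.nA a) y = M.typeAt Γ (M.nA a) y' :=
  congrFun h (some ⟨_, ha⟩)

theorem mem_VA_iff_of_profileA_eq {x x' : M.WA}
    (h : M.profileA Γ y₀ x = M.profileA Γ y₀ x') {p : PA} (hp : .propA p ∈ Γ) :
    x ∈ M.VA p ↔ x' ∈ M.VA p := by
  simpa only [AKSat] using sat_congr_of_typeAt_eq (typeAt_base_eq_of_profileA_eq h) hp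

theorem mem_VK_iff_of_profileK_eq {y y' : M.WK}
    (h : M.profileK Γ x₀ y = M.profileK Γ x₀ y') {p : PK} (hp : .propK p ∈ Γ) :
    y ∈ M.VK p ↔ y' ∈ M.VK p := by
  simpa only [AKSat] using sat_congr_of_typeAt_eq (typeAt_base_eq_of_profileK_eq h) hp

theorem eq_nA_iff_of_profileA_eq {x x' : M.WA}
    (h : M.profileA Γ y₀ x = M.profileA Γ y₀ x') {a : NA} (ha : .nomA a ∈ Γ) :
    x = M.nA a ↔ x' = M.nA a := by
  simpa only [AKSat] using sat_congr_of_typeAt_eq (typeAt_base_eq_of_profileA_eq h) ha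

theorem eq_nK_iff_of_profileK_eq {y y' : M.WK}
    (h : M.profileK Γ x₀ y = M.profileK Γ x₀ y') {k : NK} (hk : .nomK k ∈ Γ) :
    y = M.nK k ↔ y' = M.nK k := by
  simpa only [AKSat] using sat_congr_of_typeAt_eq (typeAt_base_eq_of_profileK_eq h) hk

theorem exists_entry (X : M.PointA Γ y₀) (Y : M.PointK Γ x₀) :
    ∃ e : M.WA × M.WK, M.profileA Γ y₀ e.1 = X.1.1 ∧ M.profileK Γ x₀ e.2 = Y.1.1 ∧
      ∀ x y, M.profileA Γ y₀ x = X.1.1 → M.profileK Γ x₀ y = Y.1.1 →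
        M.typeAt Γ x y = X.1.2 ∆ Y.1.2 → M.typeAt Γ e.1 e.2 = X.1.2 ∆ Y.1.2 := by
  by_cases h : ∃ x y, M.profileA Γ y₀ x = X.1.1 ∧ M.profileK Γ x₀ y = Y.1.1 ∧
      M.typeAt Γ x y = X.1.2 ∆ Y.1.2
  · obtain ⟨x, y, hx, hy, hxy⟩ := h
    exact ⟨(x, y), hx, hy, fun _ _ _ _ _ => hxy⟩
  · obtain ⟨x, hx, -⟩ := X.2
    obtain ⟨y, hy, -⟩ := Y.2
    exact ⟨(x, y), hx, hy, fun x y hx hy hxy => (h ⟨x, y, hx, hy, hxy⟩).elim⟩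

/-- A pair of the original model with the prescribed profiles, whose type is the symmetric
difference of the two tags whenever that type is realised by such a pair. -/
noncomputable def entry (X : M.PointA Γ y₀) (Y : M.PointK Γ x₀) : M.WA × M.WK :=
  (exists_entry X Y).choose

theorem profileA_entry (X : M.PointA Γ y₀) (Y : M.PointK Γ x₀) :
    M.profileA Γ y₀ (entry X Y).1 = X.1.1 :=
  (exists_entry X Y).choose_spec.1

theorem profileK_entry (X : M.PointA Γ y₀) (Y : M.PointK Γ x₀) :
    M.profileK Γ x₀ (entry X Y).2 = Y.1.1 :=
  (exists_entry X Y).choose_spec.2.1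

theorem typeAt_entry {X : M.PointA Γ y₀} {Y : M.PointK Γ x₀} {x : M.WA} {y : M.WK}
    (hx : M.profileA Γ y₀ x = X.1.1) (hy : M.profileK Γ x₀ y = Y.1.1)
    (h : M.typeAt Γ x y = X.1.2 ∆ Y.1.2) :
    M.typeAt Γ (entry X Y).1 (entry X Y).2 = M.typeAt Γ x y :=
  ((exists_entry X Y).choose_spec.2.2 x y hx hy h).trans h.symm

theorem exists_typeAt_entry_left (Y : M.PointK Γ x₀) (x : M.WA) {y : M.WK}
    (hy : M.profileK Γ x₀ y = Y.1.1) :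
    ∃ X : M.PointA Γ y₀, M.typeAt Γ (entry X Y).1 (entry X Y).2 = M.typeAt Γ x y := by
  by_cases hn : ∃ a, .nomA a ∈ Γ ∧ x = M.nA a
  · let X : M.PointA Γ y₀ := ⟨(M.profileA Γ y₀ x, ∅), x, rfl, fun _ => rfl⟩
    refine ⟨X, ?_⟩
    obtain ⟨a, ha, rfl⟩ := hn
    rw [(eq_nA_iff_of_profileA_eq (profileA_entry X Y) ha).2 rfl]
    exact typeAt_nA_eq_of_profileK_eq ((profileK_entry X Y).trans hy.symm) ha
  · let X : M.PointA Γ y₀ :=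
      ⟨(M.profileA Γ y₀ x, M.typeAt Γ x y ∆ Y.1.2), x, rfl, fun h => (hn h).elim⟩
    exact ⟨X, typeAt_entry rfl hy (symmDiff_symmDiff_cancel_right _ _).symm⟩

theorem exists_typeAt_entry_right (X : M.PointA Γ y₀) {x : M.WA} (y : M.WK)
    (hx : M.profileA Γ y₀ x = X.1.1) :
    ∃ Y : M.PointK Γ x₀, M.typeAt Γ (entry X Y).1 (entry X Y).2 = M.typeAt Γ x y := by
  by_cases hn : ∃ k, .nomK k ∈ Γ ∧ y = M.nK k
  · let Y : M.PointK Γ x₀ := ⟨(M.profileK Γ x₀ y, ∅), y, rfl, fun _ => rfl⟩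
    refine ⟨Y, ?_⟩
    obtain ⟨k, hk, rfl⟩ := hn
    rw [(eq_nK_iff_of_profileK_eq (profileK_entry X Y) hk).2 rfl]
    exact typeAt_nK_eq_of_profileA_eq ((profileA_entry X Y).trans hx.symm) hk
  · let Y : M.PointK Γ x₀ :=
      ⟨(M.profileK Γ x₀ y, X.1.2 ∆ M.typeAt Γ x y), y, rfl, fun h => (hn h).elim⟩
    exact ⟨Y, typeAt_entry hx rfl (symmDiff_symmDiff_cancel_left _ _).symm⟩

variable (M Γ x₀ y₀)

/-- The model on tagged profiles, with the largest accessibility relations respecting the boxed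
formulas of `Γ`. -/
noncomputable def profileModel : AKModel PA PK NA NK where
  WA := M.PointA Γ y₀
  WK := M.PointK Γ x₀
  neWA := ⟨⟨(M.profileA Γ y₀ x₀, ∅), x₀, rfl, fun _ => rfl⟩⟩
  neWK := ⟨⟨(M.profileK Γ x₀ y₀, ∅), y₀, rfl, fun _ => rfl⟩⟩
  R Y X X' := ∀ χ, .boxA χ ∈ Γ → χ ∈ Γ → AKSat M (entry X Y).1 (entry X Y).2 (.boxA χ) →
    AKSat M (entry X' Y).1 (entry X' Y).2 χ
  S X Y Y' := ∀ χ, .boxK χ ∈ Γ → χ ∈ Γ → AKSat M (entry X Y).1 (entry X Y).2 (.boxK χ) →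
    AKSat M (entry X Y').1 (entry X Y').2 χ
  VA p := {X | ∃ x ∈ M.VA p, M.profileA Γ y₀ x = X.1.1}
  VK p := {Y | ∃ y ∈ M.VK p, M.profileK Γ x₀ y = Y.1.1}
  nA a := ⟨(M.profileA Γ y₀ (M.nA a), ∅), M.nA a, rfl, fun _ => rfl⟩
  nK k := ⟨(M.profileK Γ x₀ (M.nK k), ∅), M.nK k, rfl, fun _ => rfl⟩

theorem sat_profileModel_iff (ψ : AKForm PA PK NA NK) (hψ : ψ.closure ⊆ Γ)
    (X : M.PointA Γ y₀) (Y : M.PointK Γ x₀) :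
    AKSat (M.profileModel Γ x₀ y₀) X Y ψ ↔ AKSat M (entry X Y).1 (entry X Y).2 ψ := by
  have hmem := hψ ψ.self_mem_closure
  induction ψ generalizing X Y with
  | propA p =>
    simp only [AKSat]
    constructor
    · rintro ⟨x, hx, h⟩
      exact (mem_VA_iff_of_profileA_eq (h.trans (profileA_entry X Y).symm) hmem).1 hx
    · exact fun h => ⟨_, h, profileA_entry X Y⟩
  | propK p =>
    simp only [AKSat]
    constructor
    · rintro ⟨y, hy, h⟩
      exact (mem_VK_iff_of_profileK_eq (h.trans (profileK_entry X Y).symm) hmem).1 hy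
    · exact fun h => ⟨_, h, profileK_entry X Y⟩
  | nomA a =>
    simp only [AKSat]
    have hX := profileA_entry X Y
    constructor
    · rintro rfl
      exact (eq_nA_iff_of_profileA_eq hX hmem).2 rfl
    · intro h
      rw [h] at hX
      obtain ⟨x, hx, hn⟩ := X.2
      have hxa := (eq_nA_iff_of_profileA_eq (hx.trans hX.symm) hmem).2 rfl
      exact Subtype.ext (Prod.ext hX.symm (hn ⟨a, hmem, hxa⟩))
  | nomK k =>
    simp only [AKSat]
    have hY := profileK_entry X Y
    constructor
    · rintro rfl
      exact (eq_nK_iff_of_profileK_eq hY hmem).2 rfl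
    · intro h
      rw [h] at hY
      obtain ⟨y, hy, hn⟩ := Y.2
      have hyk := (eq_nK_iff_of_profileK_eq (hy.trans hY.symm) hmem).2 rfl
      exact Subtype.ext (Prod.ext hY.symm (hn ⟨k, hmem, hyk⟩))
  | neg ψ ih =>
    have hsub : ψ.closure ⊆ Γ := fun χ hχ => hψ (Or.inr hχ)
    exact not_congr (ih hsub X Y (hsub ψ.self_mem_closure))
  | and ψ χ ihψ ihχ =>
    have hsub : ψ.closure ⊆ Γ := fun θ hθ => hψ (Or.inr (Or.inl hθ))
    have hsub' : χ.closure ⊆ Γ := fun θ hθ => hψ (Or.inr (Or.inr hθ))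
    exact and_congr (ihψ hsub X Y (hsub ψ.self_mem_closure))
      (ihχ hsub' X Y (hsub' χ.self_mem_closure))
  | boxA ψ ih =>
    have hsub : ψ.closure ⊆ Γ := fun χ hχ => hψ (Or.inr hχ)
    have hψΓ := hsub ψ.self_mem_closure
    constructor
    · intro h x' hx'
      obtain ⟨X', hX'⟩ := exists_typeAt_entry_left (y₀ := y₀) Y x' (profileK_entry X Y)
      refine (sat_congr_of_typeAt_eq hX' hψΓ).1 ((ih hsub X' Y hψΓ).1 (h X' ?_))
      exact fun χ _ hχ hbox => (sat_congr_of_typeAt_eq hX' hχ).2 (hbox x' hx')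
    · exact fun h X' hX' => (ih hsub X' Y hψΓ).2 (hX' ψ hmem hψΓ h)
  | boxK ψ ih =>
    have hsub : ψ.closure ⊆ Γ := fun χ hχ => hψ (Or.inr hχ)
    have hψΓ := hsub ψ.self_mem_closure
    constructor
    · intro h y' hy'
      obtain ⟨Y', hY'⟩ := exists_typeAt_entry_right (x₀ := x₀) X y' (profileA_entry X Y)
      refine (sat_congr_of_typeAt_eq hY' hψΓ).1 ((ih hsub X Y' hψΓ).1 (h Y' ?_))
      exact fun χ _ hχ hbox => (sat_congr_of_typeAt_eq hY' hχ).2 (hbox y' hy')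
    · exact fun h Y' hY' => (ih hsub X Y' hψΓ).2 (hY' ψ hmem hψΓ h)
  | atA a ψ ih =>
    have hsub : ψ.closure ⊆ Γ := fun χ hχ => hψ (Or.inr (Or.inr hχ))
    have hψΓ := hsub ψ.self_mem_closure
    have ha : .nomA a ∈ Γ := hψ (Or.inr (Or.inl rfl))
    let X' : M.PointA Γ y₀ := (M.profileModel Γ x₀ y₀).nA a
    refine (ih hsub X' Y hψΓ).trans ?_
    rw [(eq_nA_iff_of_profileA_eq (profileA_entry X' Y) ha).2 rfl]
    exact sat_congr_of_typeAt_eq (typeAt_nA_eq_of_profileK_eq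
      ((profileK_entry X' Y).trans (profileK_entry X Y).symm) ha) hψΓ
  | atK k ψ ih =>
    have hsub : ψ.closure ⊆ Γ := fun χ hχ => hψ (Or.inr (Or.inr hχ))
    have hψΓ := hsub ψ.self_mem_closure
    have hk : .nomK k ∈ Γ := hψ (Or.inr (Or.inl rfl))
    let Y' : M.PointK Γ x₀ := (M.profileModel Γ x₀ y₀).nK k
    refine (ih hsub X Y' hψΓ).trans ?_
    rw [(eq_nK_iff_of_profileK_eq (profileK_entry X Y') hk).2 rfl]
    exact sat_congr_of_typeAt_eq (typeAt_nK_eq_of_profileA_eq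
      ((profileA_entry X Y').trans (profileA_entry X Y).symm) hk) hψΓ

end AKModel

/-- finite model property: if φ is not AK-valid, then φ fails at some
    pair of an AK model whose domains W_A and W_K are both finite. -/
theorem ak_finite_model_property
    {PA PK NA NK : Type} [Countable PA] [Countable PK] [Countable NA] [Countable NK]
    (φ : AKForm PA PK NA NK) (h : ¬ AKValid φ) :
    ∃ M : AKModel PA PK NA NK, Finite M.WA ∧ Finite M.WK ∧
      ∃ (x : M.WA) (y : M.WK), ¬ AKSat M x y φ := by
  simp only [AKValid, not_forall] at h
  obtain ⟨M, x₀, y₀, hφ⟩ := h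
  have : Finite φ.closure := φ.finite_closure
  let Y : M.PointK φ.closure x₀ := ⟨(M.profileK _ x₀ y₀, ∅), y₀, rfl, fun _ => rfl⟩
  obtain ⟨X, hX⟩ := AKModel.exists_typeAt_entry_left (y₀ := y₀) Y x₀ rfl
  refine ⟨M.profileModel φ.closure x₀ y₀, Subtype.finite, Subtype.finite, X, Y, ?_⟩
  rw [M.sat_profileModel_iff φ.closure x₀ y₀ φ subset_rfl,
    AKModel.sat_congr_of_typeAt_eq hX φ.self_mem_closure]
  exact hφ
end
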